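/- arXiv:1902.03369 — 2 statements merged into one kernel-verified Lean document; each statement's English description precedes it below -/
import Mathlib

section
/- Theorem 1 (adaptive protocol with perfect match): (i) The i.i.d. state ρ = (|G⟩⟨G|)^{⊗(N+1)} passes the N-random sampling test of Ω(𝒜) with acceptance probability p = 1. (ii) For N ≥ 1 and β ≥ m/(N+m), for every state ρ on ((ℂ²)^{⊗n})^{⊗(N+1)} whose acceptance probability p for the N-random sampling test of Ω(𝒜) satisfies p ≥ β, the conditional state σ of the remaining copy satisfies ⟨G|σ|G⟩ ≥ 1 − m(1−β)/(Nβ). -/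
open scoped BigOperators ComplexOrder
open Matrix Complex

noncomputable section

/-- Computational-basis index set of `(ℂ²)^{⊗n}`. -/
abbrev QIdx (n : ℕ) := Fin n → Fin 2

/-- Linear operators on `(ℂ²)^{⊗n}`, represented as matrices. -/
abbrev QOp (n : ℕ) := Matrix (QIdx n) (QIdx n) ℂ

/-- A bit viewed as a real number. -/
def bR (b : Fin 2) : ℝ := (b : ℕ)

/-- The ℓ²→ℓ² operator norm of a matrix. -/
noncomputable def opNorm {ι : Type*} [Fintype ι] [DecidableEq ι] (M : Matrix ι ι ℂ) : ℝ :=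
  ‖Matrix.toEuclideanCLM (𝕜 := ℂ) M‖

/-- The weighted graph state `|G⟩`, as amplitudes
`⟨z|G⟩ = 2^{-n/2} ∏_{j<k} e^{i θ_{jk} z_j z_k}` (for symmetric `θ`,
`∑_{j<k} = (1/2) ∑_{j,k}`). -/
noncomputable def gVec (n : ℕ) (θ : Fin n → Fin n → ℝ) : QIdx n → ℂ :=
  fun z => ((Real.sqrt (2 ^ n))⁻¹ : ℝ) *
    Complex.exp (Complex.I * ((1 / 2 * ∑ j, ∑ k, θ j k * bR (z j) * bR (z k) : ℝ) : ℂ))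

/-- The rank-one projection `|G⟩⟨G|`. -/
noncomputable def gProj (n : ℕ) (θ : Fin n → Fin n → ℝ) : QOp n :=
  Matrix.vecMulVec (gVec n θ) (star (gVec n θ))

/-- `α_k(z) = ∑_{j ∈ C_k} θ_{jk} z_j` (using `θ_{jk} = 0` on non-edges). -/
noncomputable def alphaAngle (n : ℕ) (θ : Fin n → Fin n → ℝ) (k : Fin n) (z : QIdx n) : ℝ :=
  ∑ j, θ j k * bR (z j)

/-- The discretization `α ↦ α^h`, the unique point `jπ/h` with
`jπ/h - π/(2h) ≤ α < jπ/h + π/(2h)`. -/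
noncomputable def alphaH (h : ℕ) (α : ℝ) : ℝ :=
  (⌊(h : ℝ) * α / Real.pi + 1 / 2⌋ : ℤ) * Real.pi / h

/-- Matrix entry `⟨b|α⟩⟨α|b'⟩ = (1/2) e^{iα(b-b')}` of the projection onto
`|α⟩ = (|0⟩ + e^{iα}|1⟩)/√2`. -/
noncomputable def phaseFac (α : ℝ) (b b' : Fin 2) : ℂ :=
  (1 / 2 : ℂ) * Complex.exp (Complex.I * ((α * (bR b - bR b') : ℝ) : ℂ))

/-- The projection `P_l = ∏_{k ∈ A_l} Q_k`, written out entrywise: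
`P_l = ∑_z (⊗_{k∈A_l} |α_k(z)⟩⟨α_k(z)|) ⊗ |z⟩⟨z|_{A_l^c}`. -/
noncomputable def Pop (n : ℕ) (θ : Fin n → Fin n → ℝ) (A : Finset (Fin n)) : QOp n :=
  Matrix.of fun x y =>
    if ∀ j ∉ A, x j = y j then ∏ k ∈ A, phaseFac (alphaAngle n θ k x) (x k) (y k) else 0

/-- The test operator `Ω(𝒜) = (1/m) ∑_l P_l`. -/
noncomputable def OmegaA (n m : ℕ) (θ : Fin n → Fin n → ℝ) (A : Fin m → Finset (Fin n)) :
    QOp n :=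
  (m : ℂ)⁻¹ • ∑ l, Pop n θ (A l)

/-- The discretized projection `P_{l;h}` (replace `α_k(z)` by `α_k^h(z)`). -/
noncomputable def PopH (n : ℕ) (θ : Fin n → Fin n → ℝ) (h : ℕ) (A : Finset (Fin n)) : QOp n :=
  Matrix.of fun x y =>
    if ∀ j ∉ A, x j = y j then
      ∏ k ∈ A, phaseFac (alphaH h (alphaAngle n θ k x)) (x k) (y k) else 0

/-- The discretized test operator `Ω_h(𝒜) = (1/m) ∑_l P_{l;h}`. -/
noncomputable def OmegaAH (n m : ℕ) (θ : Fin n → Fin n → ℝ) (h : ℕ)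
    (A : Fin m → Finset (Fin n)) : QOp n :=
  (m : ℂ)⁻¹ • ∑ l, PopH n θ h (A l)

/-- Entry of the single-site operator `(1/h) |α⟩⟨α| + (1 - 1/h) I`. -/
noncomputable def mixFac (h : ℕ) (α : ℝ) (b b' : Fin 2) : ℂ :=
  (1 - (h : ℂ)⁻¹) * (if b = b' then 1 else 0) + (h : ℂ)⁻¹ * phaseFac α b b'

/-- `P̄_l = ∏_{k ∈ A_l} ((1/h(k)) Q_k + (1 - 1/h(k)) I)`, written out entrywise. -/
noncomputable def PBar (n : ℕ) (θ : Fin n → Fin n → ℝ) (hf : Fin n → ℕ) (A : Finset (Fin n)) :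
    QOp n :=
  Matrix.of fun x y =>
    if ∀ j ∉ A, x j = y j then ∏ k ∈ A, mixFac (hf k) (alphaAngle n θ k x) (x k) (y k) else 0

/-- `Ω̄(𝒜)_𝐡 = (1/m) ∑_l P̄_l`. -/
noncomputable def OmegaBar (n m : ℕ) (θ : Fin n → Fin n → ℝ) (hf : Fin n → ℕ)
    (A : Fin m → Finset (Fin n)) : QOp n :=
  (m : ℂ)⁻¹ • ∑ l, PBar n θ hf (A l)

/-- `P̄_{l;h} = ∏_{k ∈ A_l} ((1/h) Q_{k;h} + (1 - 1/h) I)`, written out entrywise. -/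
noncomputable def PBarH (n : ℕ) (θ : Fin n → Fin n → ℝ) (h : ℕ) (A : Finset (Fin n)) : QOp n :=
  Matrix.of fun x y =>
    if ∀ j ∉ A, x j = y j then
      ∏ k ∈ A, mixFac h (alphaH h (alphaAngle n θ k x)) (x k) (y k) else 0

/-- `Ω̄_h(𝒜) = (1/m) ∑_l P̄_{l;h}`. -/
noncomputable def OmegaBarH (n m : ℕ) (θ : Fin n → Fin n → ℝ) (h : ℕ)
    (A : Fin m → Finset (Fin n)) : QOp n :=
  (m : ℂ)⁻¹ • ∑ l, PBarH n θ h (A l)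

/-- Index set for `N+1` copies of the `n`-qubit space. -/
abbrev BIdx (n N : ℕ) := Fin (N + 1) → QIdx n

/-- `(⊗_{j ≠ i} Ω) ⊗ I_i` acting on the `N+1` copies. -/
noncomputable def testAll (n N : ℕ) (Ω : QOp n) (i : Fin (N + 1)) :
    Matrix (BIdx n N) (BIdx n N) ℂ :=
  Matrix.of fun x y =>
    (if x i = y i then 1 else 0) * ∏ j ∈ Finset.univ.erase i, Ω (x j) (y j)

/-- Acceptance probability `p = (1/(N+1)) ∑_i Tr[((⊗_{j≠i} Ω) ⊗ I_i) ρ]` of the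
`N`-random sampling test of `Ω` on a state `ρ` of `N+1` copies. -/
noncomputable def acceptProb (n N : ℕ) (Ω : QOp n) (ρ : Matrix (BIdx n N) (BIdx n N) ℂ) : ℝ :=
  (((N : ℂ) + 1)⁻¹ * ∑ i, (testAll n N Ω i * ρ).trace).re

/-- Partial trace over all copies except copy `i`. -/
noncomputable def ptraceAt (n N : ℕ) (i : Fin (N + 1))
    (M : Matrix (BIdx n N) (BIdx n N) ℂ) : QOp n :=
  Matrix.of fun a b => ∑ x : BIdx n N, if x i = a then M x (Function.update x i b) else 0

/-- The conditional state of the remaining copy given that the test is passed: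
`σ = (1/((N+1)p)) ∑_i Tr_{j≠i}[((⊗_{j≠i} Ω) ⊗ I_i) ρ]`. -/
noncomputable def condState (n N : ℕ) (Ω : QOp n) (ρ : Matrix (BIdx n N) (BIdx n N) ℂ) :
    QOp n :=
  (((((N : ℝ) + 1) * acceptProb n N Ω ρ : ℝ) : ℂ))⁻¹ •
    ∑ i, ptraceAt n N i (testAll n N Ω i * ρ)

/-- The i.i.d. state `(|G⟩⟨G|)^{⊗(N+1)}`. -/
noncomputable def iidState (n N : ℕ) (θ : Fin n → Fin n → ℝ) :
    Matrix (BIdx n N) (BIdx n N) ℂ :=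
  Matrix.of fun x y => ∏ j, gVec n θ (x j) * star (gVec n θ (y j))


lemma ps_prod_ite {ι R : Type*} [Fintype ι] [DecidableEq ι] [CommMonoid R] (i : ι) (X Y : ι → R) :
    ∏ j, (if j = i then X j else Y j) = X i * ∏ j ∈ Finset.univ.erase i, Y j := by
  rw [← Finset.mul_prod_erase Finset.univ _ (Finset.mem_univ i)]
  simp only [if_true]
  congr 1
  apply Finset.prod_congr rfl
  intro j hj
  rw [if_neg (Finset.ne_of_mem_erase hj)]

/-- Pointwise (classical) inequality. -/
lemma ps_pointwise (m N : ℕ) (hm : 1 ≤ m) (f : Fin (N + 1) → ℝ) (S : Finset (Fin (N + 1)))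
    (h0 : ∀ j, 0 ≤ f j) (h1 : ∀ j ∉ S, f j ≤ 1) (hc : ∀ j ∈ S, f j ≤ 1 - (m : ℝ)⁻¹) :
    (N : ℝ) * ∑ i, ((if i ∈ S then (1 : ℝ) else 0) * ∏ j ∈ Finset.univ.erase i, f j)
      + m * ∑ i, ∏ j ∈ Finset.univ.erase i, f j ≤ m * ((N : ℝ) + 1) := by
  have hm0 : (0 : ℝ) < m := by exact_mod_cast hm
  have hm1 : (1 : ℝ) ≤ m := by exact_mod_cast hm
  set c : ℝ := 1 - (m : ℝ)⁻¹ with hcdef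
  have hc0 : 0 ≤ c := by
    have : (m : ℝ)⁻¹ ≤ 1 := inv_le_one_of_one_le₀ hm1
    linarith
  have hmc : (m : ℝ) * c = m - 1 := by rw [hcdef]; field_simp
  have hprod : ∀ i, ∏ j ∈ Finset.univ.erase i, f j ≤ c ^ (S.erase i).card := by
    intro i
    calc ∏ j ∈ Finset.univ.erase i, f j
        ≤ ∏ j ∈ Finset.univ.erase i, (if j ∈ S then c else 1) := by
          apply Finset.prod_le_prod
          · intro j _; exact h0 j
          · intro j _
            split_ifs with h
            · exact hc j h
            · exact h1 j h
      _ = c ^ (S.erase i).card := by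
          rw [Finset.prod_ite]
          simp only [Finset.prod_const, one_pow, mul_one]
          congr 2
          ext j; simp [and_comm]
  set k := S.card with hk
  have hkN : k ≤ N + 1 := by
    have := Finset.card_le_univ S
    simpa using this
  have e1 : ∑ i, ((if i ∈ S then (1 : ℝ) else 0) * c ^ (S.erase i).card) = k * c ^ (k - 1) := by
    simp only [ite_mul, one_mul, zero_mul]
    rw [Finset.sum_ite_mem, Finset.univ_inter]
    rw [Finset.sum_congr rfl (g := fun _ => c ^ (k - 1))]
    · simp [hk]
    · intro i hi; rw [Finset.card_erase_of_mem hi]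
  have e2 : ∑ i, c ^ (S.erase i).card = k * c ^ (k - 1) + ((N : ℝ) + 1 - k) * c ^ k := by
    rw [← Finset.sum_add_sum_compl S]
    congr 1
    · rw [Finset.sum_congr rfl (g := fun _ => c ^ (k - 1))]
      · simp [hk]
      · intro i hi; rw [Finset.card_erase_of_mem hi]
    · rw [Finset.sum_congr rfl (g := fun _ => c ^ k)]
      · simp only [Finset.sum_const, Finset.card_compl, Fintype.card_fin, nsmul_eq_mul, ← hk]
        rw [Nat.cast_sub hkN]; push_cast; ring
      · intro i hi
        rw [Finset.erase_eq_of_notMem (by simpa using hi)]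
  have b1 : ∑ i, ((if i ∈ S then (1 : ℝ) else 0) * ∏ j ∈ Finset.univ.erase i, f j)
      ≤ k * c ^ (k - 1) := by
    rw [← e1]
    apply Finset.sum_le_sum
    intro i _
    apply mul_le_mul_of_nonneg_left (hprod i)
    split_ifs <;> norm_num
  have b2 : ∑ i, ∏ j ∈ Finset.univ.erase i, f j
      ≤ k * c ^ (k - 1) + ((N : ℝ) + 1 - k) * c ^ k := by
    rw [← e2]
    exact Finset.sum_le_sum fun i _ => hprod i
  have hN0 : (0 : ℝ) ≤ N := Nat.cast_nonneg N
  refine (add_le_add (mul_le_mul_of_nonneg_left b1 hN0)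
    (mul_le_mul_of_nonneg_left b2 hm0.le)).trans ?_
  rcases Nat.eq_zero_or_pos k with hk0 | hkpos
  · rw [hk0]; simp
  · obtain ⟨r, hr⟩ : ∃ r, k = r + 1 := ⟨k - 1, by omega⟩
    rw [hr]
    simp only [Nat.add_sub_cancel]
    push_cast
    have hb : c ^ r * (1 + r * (m : ℝ)⁻¹) ≤ 1 := by
      have := one_add_mul_le_pow (a := (m : ℝ)⁻¹) (by
        have : (0 : ℝ) < (m : ℝ)⁻¹ := inv_pos.mpr hm0
        linarith) r
      calc c ^ r * (1 + r * (m : ℝ)⁻¹) ≤ c ^ r * (1 + (m : ℝ)⁻¹) ^ r :=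
            mul_le_mul_of_nonneg_left this (pow_nonneg hc0 r)
        _ = (c * (1 + (m : ℝ)⁻¹)) ^ r := by rw [mul_pow]
        _ ≤ 1 := by
          have hi : (0 : ℝ) < (m : ℝ)⁻¹ := inv_pos.mpr hm0
          apply pow_le_one₀
          · positivity
          · rw [hcdef]; nlinarith
    have hb2 : c ^ r * (m + r) ≤ m := by
      have := mul_le_mul_of_nonneg_left hb hm0.le
      calc c ^ r * (m + r) = m * (c ^ r * (1 + r * (m : ℝ)⁻¹)) := by field_simp
        _ ≤ m * 1 := this
        _ = m := mul_one _
    calc (N : ℝ) * ((r + 1) * c ^ r) + m * ((r + 1) * c ^ r + (N + 1 - (r + 1)) * c ^ (r + 1))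
        = c ^ r * (N * (r + 1) + m * (r + 1) + (N - r) * (m * c)) := by ring
      _ = (N + 1) * (c ^ r * (m + r)) := by rw [hmc]; ring
      _ ≤ (N + 1) * m := mul_le_mul_of_nonneg_left hb2 (by positivity)
      _ = m * (N + 1) := by ring

/-- sign character -/
noncomputable def psSign (b c : Fin 2) : ℂ := if b = 1 ∧ c = 1 then -1 else 1

/-- the eigenbasis -/
noncomputable def psV (n : ℕ) (θ : Fin n → Fin n → ℝ) : QOp n :=
  Matrix.of fun x w => gVec n θ x * ∏ j, psSign (w j) (x j)

/-- indicator eigenvalue of `P_A`. -/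
noncomputable def psInd {n : ℕ} (A : Finset (Fin n)) (w : QIdx n) : ℝ :=
  ∏ j, (if j ∈ A ∧ w j = 1 then 0 else 1)

lemma ps_star_sign (b c : Fin 2) : star (psSign b c) = psSign b c := by
  unfold psSign; split_ifs <;> simp

lemma ps_phase (n : ℕ) (θ : Fin n → Fin n → ℝ) (hsym : ∀ j k, θ j k = θ k j)
    (A : Finset (Fin n)) (hA : ∀ j ∈ A, ∀ k ∈ A, θ j k = 0)
    (x y : QIdx n) (hxy : ∀ j ∉ A, x j = y j) :
    (1 / 2 * ∑ j, ∑ k, θ j k * bR (x j) * bR (x k))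
      - (1 / 2 * ∑ j, ∑ k, θ j k * bR (y j) * bR (y k))
      = ∑ k ∈ A, alphaAngle n θ k x * (bR (x k) - bR (y k)) := by
  have h1 : ∑ k ∈ A, alphaAngle n θ k x * (bR (x k) - bR (y k))
      = ∑ j, ∑ k, θ j k * bR (x j) * (bR (x k) - bR (y k)) := by
    rw [Finset.sum_comm]
    rw [Finset.sum_subset (Finset.subset_univ A)]
    · apply Finset.sum_congr rfl
      intro k _
      rw [alphaAngle, Finset.sum_mul]
    · intro k _ hk
      rw [hxy k hk]; ring
  have h2 : ∑ j, ∑ k, θ j k * bR (x j) * (bR (x k) - bR (y k))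
      = ∑ j, ∑ k, θ j k * bR (x k) * (bR (x j) - bR (y j)) := by
    rw [Finset.sum_comm]
    refine Finset.sum_congr rfl fun j _ => Finset.sum_congr rfl fun k _ => ?_
    rw [hsym]
  have h3 : (∑ j, ∑ k, θ j k * bR (x j) * bR (x k)) - ∑ j, ∑ k, θ j k * bR (y j) * bR (y k)
      = ∑ j, ∑ k, θ j k * bR (x j) * (bR (x k) - bR (y k))
        + ∑ j, ∑ k, θ j k * bR (x k) * (bR (x j) - bR (y j)) := by
    simp only [← Finset.sum_sub_distrib, ← Finset.sum_add_distrib]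
    refine Finset.sum_congr rfl fun j _ => Finset.sum_congr rfl fun k _ => ?_
    have : θ j k * (bR (x j) - bR (y j)) * (bR (x k) - bR (y k)) = 0 := by
      by_cases hj : j ∈ A
      · by_cases hk : k ∈ A
        · rw [hA j hj k hk]; ring
        · rw [hxy k hk]; ring
      · rw [hxy j hj]; ring
    linear_combination -this
  rw [h1, ← mul_sub, h3, ← h2]; ring

lemma ps_gg (n : ℕ) (θ : Fin n → Fin n → ℝ) (x y : QIdx n) :
    gVec n θ x * star (gVec n θ y) = (2 ^ n : ℂ)⁻¹ *
      Complex.exp (Complex.I * (((1 / 2 * ∑ j, ∑ k, θ j k * bR (x j) * bR (x k))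
      - (1 / 2 * ∑ j, ∑ k, θ j k * bR (y j) * bR (y k)) : ℝ) : ℂ)) := by
  unfold gVec
  generalize (1 / 2 * ∑ j, ∑ k, θ j k * bR (x j) * bR (x k)) = a
  generalize (1 / 2 * ∑ j, ∑ k, θ j k * bR (y j) * bR (y k)) = b
  have h : (((Real.sqrt (2 ^ n))⁻¹ : ℝ) : ℂ) * (((Real.sqrt (2 ^ n))⁻¹ : ℝ) : ℂ)
      = (2 ^ n : ℂ)⁻¹ := by
    rw [← Complex.ofReal_mul, ← mul_inv, Real.mul_self_sqrt (by positivity)]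
    push_cast; rfl
  rw [star_mul', Complex.star_def, Complex.conj_ofReal, ← Complex.exp_conj,
    map_mul, Complex.conj_I, Complex.conj_ofReal, ← h, Complex.ofReal_sub, mul_sub,
    sub_eq_add_neg, Complex.exp_add]
  rw [neg_mul]
  ring

lemma ps_Pop (n : ℕ) (θ : Fin n → Fin n → ℝ) (hsym : ∀ j k, θ j k = θ k j)
    (A : Finset (Fin n)) (hA : ∀ j ∈ A, ∀ k ∈ A, θ j k = 0) (x y : QIdx n) :
    Pop n θ A x y = ∑ w, (psInd A w : ℂ) * (psV n θ x w * star (psV n θ y w)) := by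
  have e : ∀ w, (psInd A w : ℂ) * (psV n θ x w * star (psV n θ y w))
      = (gVec n θ x * star (gVec n θ y)) * ∏ j, ((if j ∈ A ∧ w j = 1 then 0 else 1) *
        (psSign (w j) (x j) * psSign (w j) (y j))) := by
    intro w
    simp only [psInd, psV, Matrix.of_apply, star_mul', star_prod, ps_star_sign,
      Finset.prod_mul_distrib, Complex.ofReal_prod]
    have : ∀ j, (((if j ∈ A ∧ w j = 1 then (0 : ℝ) else 1) : ℝ) : ℂ)
      = if j ∈ A ∧ w j = 1 then (0 : ℂ) else 1 := by intro j; split_ifs <;> simp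
    simp only [this]
    ring
  simp only [e]
  rw [← Finset.mul_sum]
  have e2 : ∑ w : QIdx n, ∏ j, ((if j ∈ A ∧ w j = 1 then (0 : ℂ) else 1) *
        (psSign (w j) (x j) * psSign (w j) (y j)))
      = ∏ j, (if j ∈ A then (1 : ℂ) else if x j = y j then 2 else 0) := by
    rw [← Fintype.prod_sum (fun j (b : Fin 2) => (if j ∈ A ∧ b = 1 then (0 : ℂ) else 1) *
        (psSign b (x j) * psSign b (y j)))]
    refine Finset.prod_congr rfl fun j _ => ?_
    rw [Fin.sum_univ_two]
    generalize x j = a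
    generalize y j = b
    by_cases hj : j ∈ A
    · simp [hj, psSign]
    · fin_cases a <;> fin_cases b <;> simp [hj, psSign] <;> norm_num
  rw [e2, ps_gg]
  simp only [Pop, Matrix.of_apply]
  split_ifs with h
  · rw [ps_phase n θ hsym A hA x y h]
    simp only [phaseFac]
    rw [Finset.prod_mul_distrib, ← Complex.exp_sum, ← Finset.mul_sum, ← Complex.ofReal_sum]
    rw [mul_assoc, mul_comm (Complex.exp _), ← mul_assoc]
    congr 1
    have : (∏ j, (if j ∈ A then (1 : ℂ) else if x j = y j then 2 else 0))
        = ∏ j, (2 * (if j ∈ A then (1 / 2 : ℂ) else 1)) := by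
      refine Finset.prod_congr rfl fun j _ => ?_
      by_cases hj : j ∈ A
      · simp [hj]
      · simp [hj, h j hj]
    rw [this, Finset.prod_mul_distrib, Finset.prod_ite_mem, Finset.univ_inter]
    simp
  · push Not at h
    obtain ⟨j, hj, hne⟩ := h
    rw [Finset.prod_eq_zero (Finset.mem_univ j), mul_zero]
    simp [hj, hne]

lemma ps_complete (n : ℕ) (θ : Fin n → Fin n → ℝ) (hsym : ∀ j k, θ j k = θ k j) (x y : QIdx n) :
    (1 : QOp n) x y = ∑ w, ((1 : ℝ) : ℂ) * (psV n θ x w * star (psV n θ y w)) := by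
  have := ps_Pop n θ hsym ∅ (by simp) x y
  simp only [psInd, Finset.notMem_empty, false_and, if_false, Finset.prod_const_one] at this
  rw [← this]
  simp [Pop, Matrix.one_apply, funext_iff]

lemma ps_orth (n : ℕ) (θ : Fin n → Fin n → ℝ) (hsym : ∀ j k, θ j k = θ k j) :
    (psV n θ)ᴴ * psV n θ = 1 := by
  rw [mul_eq_one_comm]
  ext x y
  rw [ps_complete n θ hsym x y, Matrix.mul_apply]
  simp [Matrix.conjTranspose_apply]

lemma ps_V0 (n : ℕ) (θ : Fin n → Fin n → ℝ) (x : QIdx n) : psV n θ x 0 = gVec n θ x := by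
  simp [psV, psSign]

/-- eigenvalues of Ω -/
noncomputable def psLam {n m : ℕ} (A : Fin m → Finset (Fin n)) (w : QIdx n) : ℝ :=
  (m : ℝ)⁻¹ * ∑ l, psInd (A l) w

lemma ps_Omega (n m : ℕ) (θ : Fin n → Fin n → ℝ) (hsym : ∀ j k, θ j k = θ k j)
    (A : Fin m → Finset (Fin n)) (hA : ∀ l, ∀ j ∈ A l, ∀ k ∈ A l, θ j k = 0) (x y : QIdx n) :
    OmegaA n m θ A x y = ∑ w, (psLam A w : ℂ) * (psV n θ x w * star (psV n θ y w)) := by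
  simp only [OmegaA, Matrix.smul_apply, Matrix.sum_apply, smul_eq_mul, psLam]
  simp only [fun l => ps_Pop n θ hsym (A l) (hA l) x y]
  rw [Finset.sum_comm, Finset.mul_sum]
  refine Finset.sum_congr rfl fun w _ => ?_
  push_cast
  rw [Finset.mul_sum, Finset.mul_sum, Finset.sum_mul]
  refine Finset.sum_congr rfl fun l _ => ?_
  ring

lemma ps_ind_nonneg {n : ℕ} (A : Finset (Fin n)) (w : QIdx n) : 0 ≤ psInd A w :=
  Finset.prod_nonneg fun j _ => by split_ifs <;> norm_num

lemma ps_ind_le_one {n : ℕ} (A : Finset (Fin n)) (w : QIdx n) : psInd A w ≤ 1 :=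
  Finset.prod_le_one (fun j _ => by split_ifs <;> norm_num) fun j _ => by split_ifs <;> norm_num

lemma ps_lam_nonneg {n m : ℕ} (A : Fin m → Finset (Fin n)) (w : QIdx n) : 0 ≤ psLam A w :=
  mul_nonneg (by positivity) (Finset.sum_nonneg fun l _ => ps_ind_nonneg _ _)

lemma ps_lam_zero {n m : ℕ} (hm : 1 ≤ m) (A : Fin m → Finset (Fin n)) :
    psLam A (0 : QIdx n) = 1 := by
  have hm0 : (m : ℝ) ≠ 0 := by positivity
  simp [psLam, psInd, hm0]

lemma ps_lam_le {n m : ℕ} (hm : 1 ≤ m) (A : Fin m → Finset (Fin n))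
    (hcover : ∀ v : Fin n, ∃ l, v ∈ A l) (w : QIdx n) (hw : w ≠ 0) :
    psLam A w ≤ 1 - (m : ℝ)⁻¹ := by
  have hm0 : (0 : ℝ) < m := by exact_mod_cast hm
  obtain ⟨v, hv⟩ := Function.ne_iff.mp hw
  obtain ⟨l, hl⟩ := hcover v
  have hv1 : w v = 1 := by
    simp only [Pi.zero_apply] at hv
    omega
  have h0 : psInd (A l) w = 0 :=
    Finset.prod_eq_zero (Finset.mem_univ v) (by simp [hl, hv1])
  have : ∑ l', psInd (A l') w ≤ (m : ℝ) - 1 := by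
    rw [← Finset.add_sum_erase Finset.univ _ (Finset.mem_univ l), h0, zero_add]
    calc _ ≤ ∑ l' ∈ Finset.univ.erase l, (1 : ℝ) :=
          Finset.sum_le_sum fun l' _ => ps_ind_le_one _ _
      _ = m - 1 := by
        simp [Finset.card_erase_of_mem, Nat.cast_sub hm]
  calc psLam A w ≤ (m : ℝ)⁻¹ * (m - 1) := mul_le_mul_of_nonneg_left this (by positivity)
    _ = _ := by field_simp

/-- tensor product of operators -/
noncomputable def psProd (n N : ℕ) (M : Fin (N + 1) → QOp n) : Matrix (BIdx n N) (BIdx n N) ℂ :=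
  Matrix.of fun x y => ∏ j, M j (x j) (y j)

/-- product basis vector -/
noncomputable def psW (n N : ℕ) (θ : Fin n → Fin n → ℝ) (W : BIdx n N) : BIdx n N → ℂ :=
  fun x => ∏ j, psV n θ (x j) (W j)

/-- diagonal of the state in the product eigenbasis -/
noncomputable def psQ (n N : ℕ) (θ : Fin n → Fin n → ℝ) (ρ : Matrix (BIdx n N) (BIdx n N) ℂ)
    (W : BIdx n N) : ℝ := (star (psW n N θ W) ⬝ᵥ (ρ *ᵥ psW n N θ W)).re

lemma ps_Q_nonneg (n N : ℕ) (θ : Fin n → Fin n → ℝ) (ρ : Matrix (BIdx n N) (BIdx n N) ℂ)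
    (hρ : ρ.PosSemidef) (W : BIdx n N) : 0 ≤ psQ n N θ ρ W :=
  (Complex.le_def.mp (hρ.dotProduct_mulVec_nonneg (psW n N θ W))).1

lemma ps_Q_eq (n N : ℕ) (θ : Fin n → Fin n → ℝ) (ρ : Matrix (BIdx n N) (BIdx n N) ℂ)
    (hρ : ρ.PosSemidef) (W : BIdx n N) :
    (psQ n N θ ρ W : ℂ) = star (psW n N θ W) ⬝ᵥ (ρ *ᵥ psW n N θ W) := by
  have := (Complex.le_def.mp (hρ.dotProduct_mulVec_nonneg (psW n N θ W))).2
  apply Complex.ext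
  · simp [psQ]
  · rw [← this]; simp

lemma ps_trace (n N : ℕ) (θ : Fin n → Fin n → ℝ) (ρ : Matrix (BIdx n N) (BIdx n N) ℂ)
    (hρ : ρ.PosSemidef) (M : Fin (N + 1) → QOp n) (μ : Fin (N + 1) → QIdx n → ℝ)
    (hM : ∀ j x y, M j x y = ∑ w, (μ j w : ℂ) * (psV n θ x w * star (psV n θ y w))) :
    (psProd n N M * ρ).trace = ((∑ W, (∏ j, μ j (W j)) * psQ n N θ ρ W : ℝ) : ℂ) := by
  have h : ∀ x y, psProd n N M x y
      = ∑ W, ((∏ j, μ j (W j) : ℝ) : ℂ) * (psW n N θ W x * star (psW n N θ W y)) := by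
    intro x y
    simp only [psProd, Matrix.of_apply, hM]
    rw [Fintype.prod_sum]
    refine Finset.sum_congr rfl fun W _ => ?_
    simp only [psW, Finset.prod_mul_distrib, Complex.ofReal_prod, star_prod]
  simp only [Matrix.trace, Matrix.diag, Matrix.mul_apply, h]
  push_cast
  simp only [ps_Q_eq n N θ ρ hρ]
  simp only [dotProduct, Matrix.mulVec, Finset.mul_sum, Finset.sum_mul, Pi.star_apply]
  rw [Finset.sum_comm]
  rw [Finset.sum_congr rfl fun y _ => Finset.sum_comm]
  rw [Finset.sum_comm]
  refine Finset.sum_congr rfl fun W _ => Finset.sum_congr rfl fun y _ =>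
    Finset.sum_congr rfl fun x _ => ?_
  ring

lemma ps_testAll (n N : ℕ) (Ω : QOp n) (i : Fin (N + 1)) :
    testAll n N Ω i = psProd n N (fun j => if j = i then 1 else Ω) := by
  ext x y
  have := ps_prod_ite i (fun j => (1 : QOp n) (x j) (y j)) (fun j => Ω (x j) (y j))
  simp only [testAll, psProd, Matrix.of_apply]
  rw [← Matrix.one_apply, ← this]
  refine Finset.prod_congr rfl fun j _ => ?_
  split_ifs <;> rfl

lemma ps_prod_trace (n N : ℕ) (M M' : Fin (N + 1) → QOp n) :
    (psProd n N M * psProd n N M').trace = ∏ j, (M j * M' j).trace := by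
  simp only [Matrix.trace, Matrix.diag, Matrix.mul_apply, psProd, Matrix.of_apply]
  rw [Fintype.prod_sum]
  refine Finset.sum_congr rfl fun x _ => ?_
  rw [Fintype.prod_sum]
  refine Finset.sum_congr rfl fun y _ => ?_
  rw [Finset.prod_mul_distrib]

lemma ps_fid (n N : ℕ) (θ : Fin n → Fin n → ℝ) (Ω : QOp n) (i : Fin (N + 1))
    (ρ : Matrix (BIdx n N) (BIdx n N) ℂ) :
    star (gVec n θ) ⬝ᵥ (ptraceAt n N i (testAll n N Ω i * ρ) *ᵥ gVec n θ)
      = (psProd n N (fun j => if j = i then gProj n θ else Ω) * ρ).trace := by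
  set g := gVec n θ with hg
  have hK : ∀ x y, psProd n N (fun j => if j = i then gProj n θ else Ω) x y
      = g (x i) * star (g (y i)) * ∏ j ∈ Finset.univ.erase i, Ω (x j) (y j) := by
    intro x y
    have := ps_prod_ite i (fun j => g (x j) * star (g (y j))) (fun j => Ω (x j) (y j))
    simp only [psProd, Matrix.of_apply]
    rw [← this]
    refine Finset.prod_congr rfl fun j _ => ?_
    split_ifs <;> rfl
  -- left side as a sum over `(x, b)`
  have hL : star g ⬝ᵥ (ptraceAt n N i (testAll n N Ω i * ρ) *ᵥ g)
      = ∑ p : BIdx n N × QIdx n, star (g (p.1 i)) * g p.2 *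
        (testAll n N Ω i * ρ) p.1 (Function.update p.1 i p.2) := by
    rw [Fintype.sum_prod_type]
    simp only [dotProduct, Matrix.mulVec, ptraceAt, Matrix.of_apply, Pi.star_apply,
      Finset.mul_sum, Finset.sum_mul]
    rw [Finset.sum_congr rfl fun a _ => Finset.sum_comm]
    rw [Finset.sum_comm]
    refine Finset.sum_congr rfl fun x _ => ?_
    rw [Finset.sum_comm]
    refine Finset.sum_congr rfl fun b _ => ?_
    rw [Finset.sum_eq_single (x i)]
    · simp; ring
    · intro a _ ha; simp [ha.symm]
    · simp
  have hR : (psProd n N (fun j => if j = i then gProj n θ else Ω) * ρ).trace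
      = ∑ p : BIdx n N × QIdx n, ∑ y, if p.2 = y i then
          g (p.1 i) * star (g (y i)) * (∏ j ∈ Finset.univ.erase i, Ω (p.1 j) (y j)) * ρ y p.1
          else 0 := by
    rw [Fintype.sum_prod_type]
    simp only [Matrix.trace, Matrix.diag, Matrix.mul_apply, hK]
    refine Finset.sum_congr rfl fun x _ => ?_
    rw [Finset.sum_comm]
    refine Finset.sum_congr rfl fun y _ => ?_
    simp
  let e : BIdx n N × QIdx n → BIdx n N × QIdx n := fun p => (Function.update p.1 i p.2, p.1 i)
  have he : Function.Involutive e := by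
    intro p; simp [e]
  rw [hL, hR, ← Equiv.sum_comp he.toPerm]
  refine Finset.sum_congr rfl fun p _ => ?_
  obtain ⟨x, b⟩ := p
  simp only [Function.Involutive.coe_toPerm, e, Function.update_self, Function.update_idem,
    Function.update_eq_self, Matrix.mul_apply, testAll, Matrix.of_apply, Finset.mul_sum]
  refine Finset.sum_congr rfl fun y _ => ?_
  have : ∏ j ∈ Finset.univ.erase i, Ω (Function.update x i b j) (y j)
      = ∏ j ∈ Finset.univ.erase i, Ω (x j) (y j) := by
    refine Finset.prod_congr rfl fun j hj => ?_
    rw [Function.update_of_ne (Finset.ne_of_mem_erase hj)]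
  rw [this]
  split_ifs with h
  · rw [h]; ring
  · ring

lemma ps_gProj (n : ℕ) (θ : Fin n → Fin n → ℝ) (x y : QIdx n) :
    gProj n θ x y = ∑ w, ((if w = 0 then 1 else 0 : ℝ) : ℂ) *
      (psV n θ x w * star (psV n θ y w)) := by
  rw [Finset.sum_eq_single 0]
  · simp [gProj, Matrix.vecMulVec_apply, ps_V0]
  · intro w _ hw; simp [hw]
  · simp

lemma ps_trace_proj (n : ℕ) (θ : Fin n → Fin n → ℝ) (hsym : ∀ j k, θ j k = θ k j)
    (M : QOp n) (μ : QIdx n → ℝ) (hμ : μ 0 = 1)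
    (hM : ∀ x y, M x y = ∑ w, (μ w : ℂ) * (psV n θ x w * star (psV n θ y w))) :
    (M * gProj n θ).trace = 1 := by
  have hM' : M = psV n θ * Matrix.diagonal (fun w => (μ w : ℂ)) * (psV n θ)ᴴ := by
    ext x y
    rw [hM, Matrix.mul_apply]
    refine Finset.sum_congr rfl fun w _ => ?_
    rw [Matrix.mul_diagonal, Matrix.conjTranspose_apply]; ring
  have hP : gProj n θ = psV n θ * Matrix.diagonal (fun w => ((if w = 0 then 1 else 0 : ℝ) : ℂ))
      * (psV n θ)ᴴ := by
    ext x y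
    rw [ps_gProj, Matrix.mul_apply]
    refine Finset.sum_congr rfl fun w _ => ?_
    rw [Matrix.mul_diagonal, Matrix.conjTranspose_apply]; ring
  have ho := ps_orth n θ hsym
  set V := psV n θ
  rw [hM', hP]
  have : ∀ D D' : QOp n, (V * D * Vᴴ * (V * D' * Vᴴ)).trace = (D * D').trace := by
    intro D D'
    have e : V * D * Vᴴ * (V * D' * Vᴴ) = V * (D * (Vᴴ * V) * D' * Vᴴ) := by
      simp only [Matrix.mul_assoc]
    rw [e, Matrix.trace_mul_comm, ho, Matrix.mul_assoc, ho]
    simp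
  rw [this, Matrix.diagonal_mul_diagonal, Matrix.trace_diagonal]
  rw [Finset.sum_eq_single (0 : QIdx n)]
  · rw [hμ, if_pos rfl]; simp
  · intro w _ hw
    rw [if_neg hw]; simp
  · intro h; exact absurd (Finset.mem_univ _) h

/-- Theorem 1 of the paper (adaptive protocol with perfect match): the i.i.d. state
`(|G⟩⟨G|)^{⊗(N+1)}` passes the `N`-random sampling test of `Ω(𝒜)` with probability `1`,
and any state passing with probability `≥ β ≥ m/(N+m)` leaves a conditional state `σ` with
`⟨G|σ|G⟩ ≥ 1 - m(1-β)/(Nβ)`. -/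
theorem adaptive_perfect_match
    (n m : ℕ) (hn : 1 ≤ n) (hm : 1 ≤ m)
    (G : SimpleGraph (Fin n)) (θ : Fin n → Fin n → ℝ)
    (hsym : ∀ j k, θ j k = θ k j)
    (hθ : ∀ j k, ¬ G.Adj j k → θ j k = 0)
    (A : Fin m → Finset (Fin n))
    (hdisj : ∀ l l', l ≠ l' → Disjoint (A l) (A l'))
    (hcover : ∀ v : Fin n, ∃ l, v ∈ A l)
    (hne : ∀ l, (A l).Nonempty)
    (hind : ∀ l, ∀ j ∈ A l, ∀ k ∈ A l, ¬ G.Adj j k)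
    (N : ℕ) (hN : 1 ≤ N)
    (β : ℝ) (hβ0 : 0 < β) (hβ1 : β ≤ 1) (hβ : (m : ℝ) / ((N : ℝ) + m) ≤ β) :
    acceptProb n N (OmegaA n m θ A) (iidState n N θ) = 1 ∧
    ∀ ρ : Matrix (BIdx n N) (BIdx n N) ℂ, ρ.PosSemidef → ρ.trace = 1 →
      β ≤ acceptProb n N (OmegaA n m θ A) ρ →
      1 - (m : ℝ) * (1 - β) / ((N : ℝ) * β) ≤
        (star (gVec n θ) ⬝ᵥ (condState n N (OmegaA n m θ A) ρ *ᵥ gVec n θ)).re := by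
  have hA : ∀ l, ∀ j ∈ A l, ∀ k ∈ A l, θ j k = 0 :=
    fun l j hj k hk => hθ j k (hind l j hj k hk)
  have hΩ := ps_Omega n m θ hsym A hA
  have h1 := ps_complete n θ hsym
  have hN0 : (0 : ℝ) < N := by exact_mod_cast hN
  have hm0 : (0 : ℝ) < m := by exact_mod_cast hm
  have hspec : ∀ (i : Fin (N + 1)) (X : QOp n) (ν : QIdx n → ℝ)
      (_ : ∀ x y, X x y = ∑ w, (ν w : ℂ) * (psV n θ x w * star (psV n θ y w)))
      (j : Fin (N + 1)) (x y : QIdx n), (if j = i then X else OmegaA n m θ A) x y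
      = ∑ w, (((if j = i then ν w else psLam A w) : ℝ) : ℂ)
        * (psV n θ x w * star (psV n θ y w)) := by
    intro i X ν hX j x y
    split_ifs
    · exact hX x y
    · exact hΩ x y
  constructor
  · have hiid : iidState n N θ = psProd n N (fun _ => gProj n θ) := by
      ext x y; rfl
    have ht : ∀ i, (testAll n N (OmegaA n m θ A) i * iidState n N θ).trace = 1 := by
      intro i
      rw [ps_testAll, hiid, ps_prod_trace]
      refine Finset.prod_eq_one fun j _ => ?_
      refine ps_trace_proj n θ hsym _ _ ?_ (hspec i 1 (fun _ => 1) h1 j)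
      split_ifs
      · rfl
      · exact ps_lam_zero hm A
    have : ((N : ℂ) + 1) ≠ 0 := by exact_mod_cast Nat.succ_ne_zero N
    simp [acceptProb, ht, this]
  · intro ρ hρ htr hp
    set Ω := OmegaA n m θ A with hΩdef
    set p := acceptProb n N Ω ρ with hpdef
    set q := psQ n N θ ρ with hq
    have hq0 : ∀ W, 0 ≤ q W := ps_Q_nonneg n N θ ρ hρ
    have hq1 : ∑ W, q W = 1 := by
      have := ps_trace n N θ ρ hρ (fun _ => 1) (fun _ _ => 1) (fun _ => h1)
      have h1' : psProd n N (fun _ => (1 : QOp n)) = 1 := by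
        ext x y
        simp [psProd, Matrix.one_apply, funext_iff, Finset.prod_ite_zero]
      rw [h1', one_mul, htr] at this
      simp only [Finset.prod_const_one, one_mul] at this
      exact_mod_cast this.symm
    set L : Fin (N + 1) → BIdx n N → ℝ :=
      fun i W => ∏ j ∈ Finset.univ.erase i, psLam A (W j) with hL
    have hT : ∀ i, (testAll n N Ω i * ρ).trace = ((∑ W, L i W * q W : ℝ) : ℂ) := by
      intro i
      rw [ps_testAll, ps_trace n N θ ρ hρ _ _ (hspec i 1 (fun _ => 1) h1)]
      congr 1
      refine Finset.sum_congr rfl fun W _ => ?_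
      rw [ps_prod_ite i (fun _ => 1) (fun j => psLam A (W j)), one_mul]
    have hF : ∀ i, star (gVec n θ) ⬝ᵥ (ptraceAt n N i (testAll n N Ω i * ρ) *ᵥ gVec n θ)
        = ((∑ W, (if W i = 0 then 1 else 0) * L i W * q W : ℝ) : ℂ) := by
      intro i
      rw [ps_fid, ps_trace n N θ ρ hρ _ _ (hspec i (gProj n θ) _ (ps_gProj n θ))]
      congr 1
      refine Finset.sum_congr rfl fun W _ => ?_
      rw [ps_prod_ite i (fun j => if W j = 0 then 1 else 0) (fun j => psLam A (W j))]
    have hpv : ((N : ℝ) + 1) * p = ∑ i, ∑ W, L i W * q W := by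
      have : p = ((N : ℝ) + 1)⁻¹ * ∑ i, ∑ W, L i W * q W := by
        rw [hpdef, acceptProb]
        simp only [hT]
        rw [← Complex.ofReal_sum]
        rw [show ((N : ℂ) + 1)⁻¹ = ((((N : ℝ) + 1)⁻¹ : ℝ) : ℂ) by push_cast; rfl,
          ← Complex.ofReal_mul, Complex.ofReal_re]
      rw [this]; field_simp
    set F := (star (gVec n θ) ⬝ᵥ (condState n N Ω ρ *ᵥ gVec n θ)).re with hFdef
    have hp0 : 0 < p := lt_of_lt_of_le hβ0 hp
    have hFv : ((N : ℝ) + 1) * p * F = ∑ i, ∑ W, (if W i = 0 then 1 else 0) * L i W * q W := by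
      have : F = (((N : ℝ) + 1) * p)⁻¹ *
          ∑ i, ∑ W, (if W i = 0 then 1 else 0) * L i W * q W := by
        rw [hFdef, condState, Matrix.smul_mulVec, dotProduct_smul, Matrix.sum_mulVec,
          dotProduct_sum]
        simp only [hF]
        rw [← Complex.ofReal_sum, ← Complex.ofReal_inv, smul_eq_mul, ← Complex.ofReal_mul,
          Complex.ofReal_re]
      rw [this]; field_simp
    have hmain : (N : ℝ) * (((N : ℝ) + 1) * p - ((N : ℝ) + 1) * p * F)
        + m * (((N : ℝ) + 1) * p) ≤ m * ((N : ℝ) + 1) := by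
      rw [hFv, hpv]
      have hpt : ∀ W, (N : ℝ) * ∑ i, (if W i = 0 then 0 else 1) * L i W + m * ∑ i, L i W
          ≤ m * ((N : ℝ) + 1) := by
        intro W
        have := ps_pointwise m N hm (fun j => psLam A (W j))
          (Finset.univ.filter fun j => W j ≠ 0) (fun j => ps_lam_nonneg _ _)
          (by
            intro j hj
            have : W j = 0 := by simpa using hj
            rw [this, ps_lam_zero hm])
          (by
            intro j hj
            exact ps_lam_le hm A hcover _ (by simpa using hj))
        simpa [hL, ite_not] using this
      calc _ = ∑ W, ((N : ℝ) * ∑ i, (if W i = 0 then 0 else 1) * L i W + m * ∑ i, L i W) * q W := by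
            rw [Finset.sum_comm, Finset.sum_comm (s := Finset.univ (α := Fin (N + 1)))
              (f := fun i W => (if W i = 0 then 1 else 0) * L i W * q W)]
            rw [← Finset.sum_sub_distrib, Finset.mul_sum, Finset.mul_sum,
              ← Finset.sum_add_distrib]
            refine Finset.sum_congr rfl fun W _ => ?_
            rw [← Finset.sum_sub_distrib, ← Finset.sum_mul, add_mul, mul_assoc, mul_assoc]
            congr 2
            rw [Finset.sum_mul]
            refine Finset.sum_congr rfl fun i _ => ?_
            split_ifs <;> ring
        _ ≤ ∑ W, (m * ((N : ℝ) + 1)) * q W :=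
            Finset.sum_le_sum fun W _ => mul_le_mul_of_nonneg_right (hpt W) (hq0 W)
        _ = m * ((N : ℝ) + 1) := by rw [← Finset.mul_sum, hq1, mul_one]
    have hmain2 : (N : ℝ) * (p - p * F) + m * p ≤ m := by
      have h : (0 : ℝ) < (N : ℝ) + 1 := by positivity
      refine le_of_mul_le_mul_left ?_ h
      nlinarith [hmain]
    have hFp : 1 - (m : ℝ) * (1 - p) / (N * p) ≤ F := by
      rw [sub_le_iff_le_add, ← sub_le_iff_le_add', le_div_iff₀ (by positivity)]
      nlinarith [hmain2]
    refine le_trans ?_ hFp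
    have : (m : ℝ) * (1 - p) / (N * p) ≤ m * (1 - β) / (N * β) := by
      rw [div_le_div_iff₀ (by positivity) (by positivity)]
      have := mul_le_mul_of_nonneg_left hp (mul_nonneg hm0.le hN0.le)
      nlinarith
    linarith

end
end

section
/- For every density matrix σ on (ℂ²)^{⊗n}, writing F := ⟨G|σ|G⟩, the discretized test operator satisfies Tr[σ Ω_h(𝒜)] ≤ 1 − (1−F)/m + (Σ_{l=1}^m |A_l|/m) sin(π/(4h)). -/
open scoped BigOperators ComplexOrder
open Matrix Complex

noncomputable section

section WG

open scoped Matrix.Norms.L2Operator MatrixOrder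

/-- General product projection with angle functions `a`. -/
def Pgen (n : ℕ) (a : Fin n → QIdx n → ℝ) (S : Finset (Fin n)) : QOp n :=
  Matrix.of fun x y =>
    if ∀ j ∉ S, x j = y j then ∏ k ∈ S, phaseFac (a k x) (x k) (y k) else 0

/-- The angles of sites in `U` depend only on the bits outside `U`. -/
def InvA (n : ℕ) (a : Fin n → QIdx n → ℝ) (U : Finset (Fin n)) : Prop :=
  ∀ k ∈ U, ∀ x y : QIdx n, (∀ j ∉ U, x j = y j) → a k x = a k y

lemma tr_nonneg {n : ℕ} {σ M : QOp n} (hσ : σ.PosSemidef) (hM : M.PosSemidef) :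
    0 ≤ ((σ * M).trace).re := by
  obtain ⟨B, rfl⟩ := CStarAlgebra.nonneg_iff_eq_star_mul_self.mp (Matrix.nonneg_iff_posSemidef.mpr hσ)
  rw [Matrix.star_eq_conjTranspose]
  have h1 : (Bᴴ * B * M).trace = (B * M * Bᴴ).trace := by
    rw [Matrix.mul_assoc, Matrix.trace_mul_comm]
  rw [h1]
  have := (hM.mul_mul_conjTranspose_same B).trace_nonneg
  exact (Complex.le_def.mp this).1

lemma tr_le_norm {n : ℕ} {σ M : QOp n} (hσ : σ.PosSemidef) (h1 : σ.trace = 1)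
    (hM : M.IsHermitian) : ((σ * M).trace).re ≤ ‖M‖ := by
  have h : M ≤ algebraMap ℝ _ ‖M‖ := IsSelfAdjoint.le_algebraMap_norm_self (a := M) hM
  have h2 := tr_nonneg hσ (Matrix.le_iff.mp h)
  rw [Matrix.mul_sub, Matrix.trace_sub, Algebra.algebraMap_eq_smul_one, Matrix.mul_smul,
    Matrix.trace_smul, Matrix.mul_one, h1] at h2
  simp at h2
  linarith

lemma star_phaseFac (α : ℝ) (b c : Fin 2) : star (phaseFac α b c) = phaseFac α c b := by
  unfold phaseFac
  simp only [star_mul', RCLike.star_def, ← Complex.exp_conj]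
  have h2 : (starRingEnd ℂ) (1 / 2) = 1 / 2 := by
    rw [map_div₀, map_one, Complex.conj_ofNat]
  rw [h2, map_mul, Complex.conj_I, Complex.conj_ofReal]
  congr 2
  push_cast; ring

lemma Pgen_herm {n : ℕ} {a : Fin n → QIdx n → ℝ} {U S : Finset (Fin n)} (ha : InvA n a U)
    (hS : S ⊆ U) : (Pgen n a S).IsHermitian := by
  ext x y
  simp only [Matrix.conjTranspose_apply, Pgen, Matrix.of_apply]
  by_cases h : ∀ j ∉ S, x j = y j
  · have h' : ∀ j ∉ S, y j = x j := fun j hj => (h j hj).symm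
    rw [if_pos h, if_pos h', star_prod]
    refine Finset.prod_congr rfl fun k hk => ?_
    rw [star_phaseFac, ha k (hS hk) y x (fun j hj => h' j (fun q => hj (hS q)))]
  · have h' : ¬ ∀ j ∉ S, y j = x j := fun q => h fun j hj => (q j hj).symm
    rw [if_neg h, if_neg h', star_zero]

lemma Pgen_mul {n : ℕ} {a : Fin n → QIdx n → ℝ} {U S T : Finset (Fin n)} (ha : InvA n a U)
    (hS : S ⊆ U) (hT : T ⊆ U) (hd : Disjoint S T) :
    Pgen n a S * Pgen n a T = Pgen n a (S ∪ T) := by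
  ext x z
  rw [Matrix.mul_apply]
  simp only [Pgen, Matrix.of_apply]
  rw [Finset.sum_eq_single (fun i => if i ∈ S then z i else x i)]
  · have e1 : ∀ j ∉ S, x j = if j ∈ S then z j else x j := by
      intro j hj; simp [hj]
    rw [if_pos e1]
    by_cases h : ∀ j ∉ S ∪ T, x j = z j
    · have e2 : ∀ j ∉ T, (if j ∈ S then z j else x j) = z j := by
        intro j hj
        by_cases hjS : j ∈ S
        · simp [hjS]
        · simp [hjS]; exact h j (by simp [hj, hjS])
      rw [if_pos h, if_pos e2, Finset.prod_union hd]
      congr 1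
      · refine Finset.prod_congr rfl fun k hk => ?_
        simp [hk]
      · refine Finset.prod_congr rfl fun k hk => ?_
        have : k ∉ S := fun q => Finset.disjoint_left.mp hd q hk
        rw [ha k (hT hk) x (fun i => if i ∈ S then z i else x i)
          (fun j hj => e1 j (fun q => hj (hS q)))]
        simp [this]
    · have e2 : ¬ ∀ j ∉ T, (if j ∈ S then z j else x j) = z j := by
        intro q
        apply h
        intro j hj
        simp only [Finset.mem_union, not_or] at hj
        have := q j hj.2
        simpa [hj.1] using this
      rw [if_neg h, if_neg e2, mul_zero]
  · intro y _ hy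
    by_cases h1 : ∀ j ∉ S, x j = y j
    · by_cases h2 : ∀ j ∉ T, y j = z j
      · exfalso
        apply hy
        funext j
        by_cases hj : j ∈ S
        · simp [hj, h2 j (Finset.disjoint_left.mp hd hj)]
        · simp [hj, h1 j hj]
      · rw [if_neg h2, mul_zero]
    · rw [if_neg h1, zero_mul]
  · simp

lemma Pgen_empty {n : ℕ} (a : Fin n → QIdx n → ℝ) : Pgen n a ∅ = 1 := by
  ext x y
  simp [Pgen, Matrix.one_apply, funext_iff]

/-- Single-site block operator. -/
def Sop (n : ℕ) (k : Fin n) (M : QIdx n → Fin 2 → Fin 2 → ℂ) : QOp n :=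
  Matrix.of fun x y => if ∀ j, j ≠ k → x j = y j then M x (x k) (y k) else 0

lemma Pgen_single {n : ℕ} (a : Fin n → QIdx n → ℝ) (k : Fin n) :
    Pgen n a {k} = Sop n k (fun x b c => phaseFac (a k x) b c) := by
  ext x y
  simp [Pgen, Sop]

lemma Sop_mul {n : ℕ} (k : Fin n) (M N : QIdx n → Fin 2 → Fin 2 → ℂ)
    (hN : ∀ x y, (∀ j, j ≠ k → x j = y j) → N x = N y) :
    Sop n k M * Sop n k N = Sop n k (fun x b d => ∑ c, M x b c * N x c d) := by
  ext x z
  rw [Matrix.mul_apply]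
  simp only [Sop, Matrix.of_apply]
  have hsum : ∀ f : QIdx n → ℂ, (∀ y, (¬ ∀ j, j ≠ k → x j = y j) → f y = 0) →
      ∑ y, f y = ∑ c, f (Function.update x k c) := by
    intro f hf
    symm
    have hinj : Function.Injective (fun c : Fin 2 => Function.update x k c) :=
      Function.update_injective x k
    have hmap := Finset.sum_map Finset.univ ⟨_, hinj⟩ f
    simp only [Function.Embedding.coeFn_mk] at hmap
    rw [← hmap]
    apply Finset.sum_subset (Finset.subset_univ _)
    intro y _ hy
    apply hf
    intro q
    apply hy
    simp only [Finset.mem_map, Finset.mem_univ, true_and, Function.Embedding.coeFn_mk]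
    refine ⟨y k, ?_⟩
    funext j
    by_cases hj : j = k
    · subst hj; simp
    · simp [hj, q j hj]
  rw [hsum]
  · have e1 : ∀ c, ∀ j, j ≠ k → x j = Function.update x k c j := by
      intro c j hj; simp [hj]
    have e2 : ∀ c, (∀ j, j ≠ k → Function.update x k c j = z j) ↔ (∀ j, j ≠ k → x j = z j) := by
      intro c
      refine forall_congr' fun j => forall_congr' fun hj => ?_
      simp [hj]
    by_cases h : ∀ j, j ≠ k → x j = z j
    · rw [if_pos h]
      refine Finset.sum_congr rfl fun c _ => ?_
      rw [if_pos (e1 c), if_pos ((e2 c).mpr h), ← hN x _ (e1 c)]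
      simp
    · rw [if_neg h]
      refine Finset.sum_eq_zero fun c _ => ?_
      rw [if_neg (fun q => h ((e2 c).mp q)), mul_zero]
  · intro y hy
    rw [if_neg hy, zero_mul]

lemma phase_idem (α : ℝ) (b d : Fin 2) :
    ∑ c, phaseFac α b c * phaseFac α c d = phaseFac α b d := by
  have : ∀ c, phaseFac α b c * phaseFac α c d = (1/2) * phaseFac α b d := by
    intro c
    unfold phaseFac
    have : Complex.exp (Complex.I * ((α * (bR b - bR d) : ℝ) : ℂ)) =
      Complex.exp (Complex.I * ((α * (bR b - bR c) : ℝ) : ℂ)) *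
      Complex.exp (Complex.I * ((α * (bR c - bR d) : ℝ) : ℂ)) := by
      rw [← Complex.exp_add]; congr 1; push_cast; ring
    rw [this]; ring
  simp [this]

lemma inv_site {n : ℕ} {a : Fin n → QIdx n → ℝ} {U : Finset (Fin n)} (ha : InvA n a U)
    {k : Fin n} (hk : k ∈ U) (x y : QIdx n) (h : ∀ j, j ≠ k → x j = y j) : a k x = a k y :=
  ha k hk x y fun j hj => h j (fun q => hj (q ▸ hk))

lemma Pgen_idem {n : ℕ} {a : Fin n → QIdx n → ℝ} {U : Finset (Fin n)} (ha : InvA n a U)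
    (S : Finset (Fin n)) (hS : S ⊆ U) : Pgen n a S * Pgen n a S = Pgen n a S := by
  induction S using Finset.induction_on with
  | empty => simp [Pgen_empty]
  | insert k S hk ih =>
    have hkU : k ∈ U := hS (Finset.mem_insert_self _ _)
    have hSU : S ⊆ U := fun j hj => hS (Finset.mem_insert_of_mem hj)
    have hkU' : {k} ⊆ U := by simpa using hkU
    have hd : Disjoint {k} S := by simpa using hk
    have e : Pgen n a (insert k S) = Pgen n a {k} * Pgen n a S := by
      rw [Pgen_mul ha hkU' hSU hd, Finset.insert_eq]
    have e' : Pgen n a {k} * Pgen n a S = Pgen n a S * Pgen n a {k} := by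
      rw [Pgen_mul ha hkU' hSU hd, Pgen_mul ha hSU hkU' hd.symm, Finset.union_comm]
    have ik : Pgen n a {k} * Pgen n a {k} = Pgen n a {k} := by
      rw [Pgen_single, Sop_mul]
      · simp only [phase_idem]
      · intro x y h
        rw [inv_site ha hkU x y h]
    rw [e]
    calc _ = Pgen n a {k} * (Pgen n a S * Pgen n a {k}) * Pgen n a S := by
          simp only [Matrix.mul_assoc]
      _ = (Pgen n a {k} * Pgen n a {k}) * (Pgen n a S * Pgen n a S) := by
          rw [← e']; simp only [Matrix.mul_assoc]
      _ = _ := by rw [ik, ih hSU]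

lemma Pgen_norm {n : ℕ} {a : Fin n → QIdx n → ℝ} {U : Finset (Fin n)} (ha : InvA n a U)
    (S : Finset (Fin n)) (hS : S ⊆ U) : ‖Pgen n a S‖ ≤ 1 :=
  IsStarProjection.norm_le (Pgen n a S) ⟨Pgen_idem ha S hS, Pgen_herm ha hS⟩

lemma phase_diff (α β : ℝ) (b d : Fin 2) :
    ∑ c, (phaseFac α b c - phaseFac β b c) * (phaseFac α c d - phaseFac β c d) =
      if b = d then ((Real.sin ((α - β) / 2) ^ 2 : ℝ) : ℂ) else 0 := by
  have key : (1/4 : ℂ) * ((Complex.exp (Complex.I * α) - Complex.exp (Complex.I * β)) *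
      (Complex.exp (-(Complex.I * α)) - Complex.exp (-(Complex.I * β)))) =
      ((Real.sin ((α - β) / 2) ^ 2 : ℝ) : ℂ) := by
    have h1 : Complex.exp (Complex.I * α) * Complex.exp (-(Complex.I * α)) = 1 := by
      rw [← Complex.exp_add]; simp
    have h2 : Complex.exp (Complex.I * β) * Complex.exp (-(Complex.I * β)) = 1 := by
      rw [← Complex.exp_add]; simp
    have h3 : Complex.exp (Complex.I * α) * Complex.exp (-(Complex.I * β)) +
        Complex.exp (Complex.I * β) * Complex.exp (-(Complex.I * α)) =
        2 * Complex.cos (α - β) := by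
      rw [← Complex.exp_add, ← Complex.exp_add, Complex.cos]
      ring_nf
    have h4 : Complex.cos (α - β) = 1 - 2 * Complex.sin ((α - β)/2) ^ 2 := by
      have := Complex.cos_two_mul ((α - β)/2 : ℂ)
      have h5 := Complex.sin_sq_add_cos_sq ((α - β)/2 : ℂ)
      rw [show 2 * ((α - β)/2 : ℂ) = α - β by ring] at this
      rw [this]; linear_combination (2:ℂ) * h5
    push_cast
    linear_combination (1/4:ℂ) * h1 + (1/4:ℂ) * h2 - (1/4:ℂ) * h3 - (1/2:ℂ) * h4
  fin_cases b <;> fin_cases d <;>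
    simp [Fin.sum_univ_two, phaseFac, bR] <;> push_cast at key <;> linear_combination key

lemma site_diff {n : ℕ} {a b : Fin n → QIdx n → ℝ} {U : Finset (Fin n)} (ha : InvA n a U)
    (hb : InvA n b U) {s : ℝ} (hs : 0 ≤ s)
    (hab : ∀ k x, Real.sin ((a k x - b k x) / 2) ^ 2 ≤ s ^ 2) {k : Fin n} (hk : k ∈ U) :
    ‖Pgen n a {k} - Pgen n b {k}‖ ≤ s := by
  have hkU' : {k} ⊆ U := by simpa using hk
  have hH : (Pgen n a {k} - Pgen n b {k}).IsHermitian :=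
    (Pgen_herm ha hkU').sub (Pgen_herm hb hkU')
  have e : Pgen n a {k} - Pgen n b {k} =
      Sop n k (fun x p q => phaseFac (a k x) p q - phaseFac (b k x) p q) := by
    rw [Pgen_single, Pgen_single]
    ext x y
    simp only [Sop, Matrix.sub_apply, Matrix.of_apply]
    split_ifs <;> simp
  have e2 : (Pgen n a {k} - Pgen n b {k}) * (Pgen n a {k} - Pgen n b {k}) =
      Matrix.diagonal (fun x => ((Real.sin ((a k x - b k x) / 2) ^ 2 : ℝ) : ℂ)) := by
    rw [e, Sop_mul]
    · simp only [phase_diff]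
      ext x y
      simp only [Sop, Matrix.of_apply, Matrix.diagonal_apply]
      by_cases h : x = y
      · subst h; simp
      · rw [if_neg h]
        split_ifs with h1 h2
        · exfalso; apply h; funext j
          by_cases hj : j = k
          · rw [hj]; exact h2
          · exact h1 j hj
        · rfl
        · rfl
    · intro x y h
      rw [inv_site ha hk x y h, inv_site hb hk x y h]
  have e3 : ‖Pgen n a {k} - Pgen n b {k}‖ * ‖Pgen n a {k} - Pgen n b {k}‖ ≤ s ^ 2 := by
    rw [← CStarRing.norm_star_mul_self, Matrix.star_eq_conjTranspose, hH.eq, e2,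
      Matrix.l2_opNorm_diagonal]
    refine (pi_norm_le_iff_of_nonneg (by positivity)).mpr fun x => ?_
    rw [Complex.norm_real, Real.norm_of_nonneg (by positivity)]
    exact hab k x
  exact abs_le_of_sq_le_sq' (by nlinarith) hs |>.2

lemma Pgen_diff {n : ℕ} {a b : Fin n → QIdx n → ℝ} {U : Finset (Fin n)} (ha : InvA n a U)
    (hb : InvA n b U) {s : ℝ} (hs : 0 ≤ s)
    (hab : ∀ k x, Real.sin ((a k x - b k x) / 2) ^ 2 ≤ s ^ 2) (S : Finset (Fin n)) (hS : S ⊆ U) :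
    ‖Pgen n a S - Pgen n b S‖ ≤ S.card * s := by
  induction S using Finset.induction_on with
  | empty => simp [Pgen_empty]
  | insert k S hk ih =>
    have hkU : k ∈ U := hS (Finset.mem_insert_self _ _)
    have hSU : S ⊆ U := fun j hj => hS (Finset.mem_insert_of_mem hj)
    have hkU' : {k} ⊆ U := by simpa using hkU
    have hd : Disjoint {k} S := by simpa using hk
    have e : Pgen n a (insert k S) - Pgen n b (insert k S) =
        (Pgen n a {k} - Pgen n b {k}) * Pgen n a S +
          Pgen n b {k} * (Pgen n a S - Pgen n b S) := by
      rw [Finset.insert_eq, ← Pgen_mul ha hkU' hSU hd, ← Pgen_mul hb hkU' hSU hd]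
      noncomm_ring
    rw [e, Finset.card_insert_of_notMem hk]
    have h1 := site_diff ha hb hs hab hkU
    have h2 := Pgen_norm ha S hSU
    have h3 := Pgen_norm hb {k} hkU'
    have h4 := ih hSU
    calc _ ≤ ‖Pgen n a {k} - Pgen n b {k}‖ * ‖Pgen n a S‖ +
          ‖Pgen n b {k}‖ * ‖Pgen n a S - Pgen n b S‖ :=
          (norm_add_le _ _).trans (add_le_add (norm_mul_le _ _) (norm_mul_le _ _))
      _ ≤ s * 1 + 1 * (S.card * s) := by gcongr
      _ = _ := by push_cast; ring

lemma alphaH_bound (h : ℕ) (hh : 1 ≤ h) (α : ℝ) :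
    Real.sin ((alphaH h α - α) / 2) ^ 2 ≤ Real.sin (Real.pi / (4 * h)) ^ 2 := by
  have hp := Real.pi_pos
  have hh' : (1:ℝ) ≤ h := by exact_mod_cast hh
  have hd : |(alphaH h α - α) / 2| ≤ Real.pi / (4 * h) := by
    unfold alphaH
    have f1 := Int.floor_le ((h : ℝ) * α / Real.pi + 1 / 2)
    have f2 := Int.lt_floor_add_one ((h : ℝ) * α / Real.pi + 1 / 2)
    set f : ℝ := ((⌊(h : ℝ) * α / Real.pi + 1 / 2⌋ : ℤ) : ℝ) with hf
    have e : (f * Real.pi / h - α) / 2 = (f - h * α / Real.pi) * (Real.pi / (2 * h)) := by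
      field_simp
    rw [e, abs_mul, abs_of_pos (show 0 < Real.pi / (2 * h) by positivity)]
    have : |f - h * α / Real.pi| ≤ 1 / 2 := abs_le.mpr ⟨by linarith, by linarith⟩
    calc _ ≤ 1 / 2 * (Real.pi / (2 * h)) := by gcongr
      _ = _ := by field_simp; norm_num
  have hle : Real.pi / (4 * h) ≤ Real.pi / 2 := by
    apply div_le_div_of_nonneg_left hp.le (by norm_num); linarith
  set t := (alphaH h α - α) / 2
  have e : Real.sin t ^ 2 = Real.sin |t| ^ 2 := by
    rcases abs_choice t with q | q <;> rw [q]
    rw [Real.sin_neg]; ring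
  rw [e]
  have h0 : 0 ≤ Real.sin |t| :=
    Real.sin_nonneg_of_nonneg_of_le_pi (abs_nonneg _) (by linarith)
  have := Real.sin_le_sin_of_le_of_le_pi_div_two (by linarith [abs_nonneg t]) hle hd
  gcongr

lemma union_bound {n m : ℕ} (A : Fin m → Finset (Fin n))
    (hdisj : ∀ l l', l ≠ l' → Disjoint (A l) (A l')) (s : Finset (Fin m)) :
    (∑ l ∈ s, (1 - Pgen n 0 (A l)) - (1 - Pgen n 0 (s.biUnion A))).PosSemidef := by
  have ha : InvA n 0 Finset.univ := fun _ _ _ _ _ => rfl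
  induction s using Finset.induction_on with
  | empty => simpa [Pgen_empty] using Matrix.PosSemidef.zero
  | insert l s hl ih =>
    have hd : Disjoint (A l) (s.biUnion A) := by
      rw [Finset.disjoint_biUnion_right]
      intro i hi
      exact hdisj l i (fun q => hl (q ▸ hi))
    have hm := Pgen_mul ha (Finset.subset_univ _) (Finset.subset_univ _) hd
    have hm' := Pgen_mul ha (Finset.subset_univ _) (Finset.subset_univ _) hd.symm
    rw [Finset.union_comm] at hm'
    rw [Finset.sum_insert hl, Finset.biUnion_insert]
    have i1 := Pgen_idem ha (A l) (Finset.subset_univ _)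
    have i2 := Pgen_idem ha (s.biUnion A) (Finset.subset_univ _)
    have s1 : (Pgen n 0 (A l)).IsHermitian := Pgen_herm ha (Finset.subset_univ _)
    have s2 : (Pgen n 0 (s.biUnion A)).IsHermitian := Pgen_herm ha (Finset.subset_univ _)
    have s3 : (Pgen n 0 (A l ∪ s.biUnion A)).IsHermitian := Pgen_herm ha (Finset.subset_univ _)
    have i3 := Pgen_idem ha (A l ∪ s.biUnion A) (Finset.subset_univ _)
    have a1 : Pgen n 0 (A l) * Pgen n 0 (A l ∪ s.biUnion A) = Pgen n 0 (A l ∪ s.biUnion A) := by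
      rw [← hm, ← Matrix.mul_assoc, i1]
    have a2 : Pgen n 0 (A l ∪ s.biUnion A) * Pgen n 0 (A l) = Pgen n 0 (A l ∪ s.biUnion A) := by
      rw [← hm', Matrix.mul_assoc, i1]
    have a3 : Pgen n 0 (s.biUnion A) * Pgen n 0 (A l ∪ s.biUnion A) =
        Pgen n 0 (A l ∪ s.biUnion A) := by
      rw [← hm', ← Matrix.mul_assoc, i2]
    have a4 : Pgen n 0 (A l ∪ s.biUnion A) * Pgen n 0 (s.biUnion A) =
        Pgen n 0 (A l ∪ s.biUnion A) := by
      rw [← hm, Matrix.mul_assoc, i2]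
    generalize Pgen n 0 (A l ∪ s.biUnion A) = R at *
    generalize Pgen n 0 (s.biUnion A) = Q at *
    generalize Pgen n 0 (A l) = P at *
    have e : (1 - P) + ∑ i ∈ s, (1 - Pgen n 0 (A i)) - (1 - R) =
        (∑ i ∈ s, (1 - Pgen n 0 (A i)) - (1 - Q)) + (1 - P - Q + R)ᴴ * (1 - P - Q + R) := by
      have : (1 - P - Q + R)ᴴ = 1 - P - Q + R := by
        simp [Matrix.conjTranspose_add, Matrix.conjTranspose_sub, s1.eq, s2.eq, s3.eq]
      rw [this]
      simp only [Matrix.mul_add, Matrix.add_mul, Matrix.mul_sub, Matrix.sub_mul, Matrix.one_mul,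
        Matrix.mul_one, i1, i2, i3, a1, a2, a3, a4, hm, hm']
      abel
    rw [e]
    exact ih.add (Matrix.posSemidef_conjTranspose_mul_self _)

/-- The diagonal phases. -/
def uPh (n : ℕ) (θ : Fin n → Fin n → ℝ) (z : QIdx n) : ℂ :=
  Complex.exp (Complex.I * ((1 / 2 * ∑ j, ∑ k, θ j k * bR (z j) * bR (z k) : ℝ) : ℂ))

lemma uPh_mul_star (n : ℕ) (θ : Fin n → Fin n → ℝ) (x y : QIdx n) :
    uPh n θ x * star (uPh n θ y) = Complex.exp (Complex.I *
      (((1 / 2 * ∑ j, ∑ k, θ j k * bR (x j) * bR (x k)) -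
        (1 / 2 * ∑ j, ∑ k, θ j k * bR (y j) * bR (y k)) : ℝ) : ℂ)) := by
  unfold uPh
  rw [RCLike.star_def, ← Complex.exp_conj, ← Complex.exp_add]
  congr 1
  rw [map_mul, Complex.conj_I, Complex.conj_ofReal]
  push_cast; ring

lemma phase_zero (b c : Fin 2) : phaseFac 0 b c = 1 / 2 := by simp [phaseFac]

lemma gProj_eq (n : ℕ) (θ : Fin n → Fin n → ℝ) :
    gProj n θ = Matrix.diagonal (uPh n θ) * Pgen n 0 Finset.univ *
      (Matrix.diagonal (uPh n θ))ᴴ := by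
  ext x y
  rw [Matrix.diagonal_conjTranspose, Matrix.mul_diagonal, Matrix.diagonal_mul]
  have e : ∀ z, gVec n θ z = ((Real.sqrt (2 ^ n))⁻¹ : ℝ) * uPh n θ z := fun z => rfl
  simp only [gProj, Matrix.vecMulVec_apply, Pi.star_apply, e, Pgen, Matrix.of_apply]
  simp only [Finset.mem_univ, not_true_eq_false, false_implies, implies_true, if_true,
    Pi.zero_apply, phase_zero, Finset.prod_const, Finset.card_univ, Fintype.card_fin]
  rw [star_mul', RCLike.star_def, Complex.conj_ofReal]
  have h2 : (((Real.sqrt (2 ^ n))⁻¹ : ℝ) : ℂ) * (((Real.sqrt (2 ^ n))⁻¹ : ℝ) : ℂ) =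
      (1 / 2) ^ n := by
    rw [← Complex.ofReal_mul, ← mul_inv, Real.mul_self_sqrt (by positivity)]
    push_cast; simp
  rw [← h2]; ring

lemma phase_identity {n : ℕ} {θ : Fin n → Fin n → ℝ} (hsym : ∀ j k, θ j k = θ k j)
    {A : Finset (Fin n)} (h0 : ∀ j ∈ A, ∀ k ∈ A, θ j k = 0) (x y : Fin n → ℝ)
    (hxy : ∀ j ∉ A, x j = y j) :
    1 / 2 * ∑ j, ∑ k, θ j k * x j * x k - 1 / 2 * ∑ j, ∑ k, θ j k * y j * y k =
      ∑ k ∈ A, (∑ j, θ j k * x j) * (x k - y k) := by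
  have e0 : ∑ k ∈ A, (∑ j, θ j k * x j) * (x k - y k) =
      ∑ k, (∑ j, θ j k * x j) * (x k - y k) := by
    apply Finset.sum_subset (Finset.subset_univ _)
    intro k _ hk
    rw [hxy k hk]; ring
  have e1 : ∑ k, (∑ j, θ j k * x j) * (x k - y k) =
      ∑ j, ∑ k, θ j k * x j * (x k - y k) := by
    rw [Finset.sum_comm]
    exact Finset.sum_congr rfl fun k _ => Finset.sum_mul _ _ _
  have e2 : ∑ j, ∑ k, θ j k * x j * y k = ∑ j, ∑ k, θ j k * y j * x k := by
    rw [Finset.sum_comm]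
    refine Finset.sum_congr rfl fun k _ => Finset.sum_congr rfl fun j _ => ?_
    rw [hsym]; ring
  have e3 : ∑ j, ∑ k, θ j k * (x j - y j) * (x k - y k) = 0 := by
    refine Finset.sum_eq_zero fun j _ => Finset.sum_eq_zero fun k _ => ?_
    by_cases hj : j ∈ A
    · by_cases hk : k ∈ A
      · rw [h0 j hj k hk]; ring
      · rw [hxy k hk]; ring
    · rw [hxy j hj]; ring
  have e4 : ∑ j, ∑ k, θ j k * (x j - y j) * (x k - y k) =
      ∑ j, ∑ k, θ j k * x j * x k - ∑ j, ∑ k, θ j k * x j * y k -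
        ∑ j, ∑ k, θ j k * y j * x k + ∑ j, ∑ k, θ j k * y j * y k := by
    simp only [← Finset.sum_sub_distrib, ← Finset.sum_add_distrib]
    refine Finset.sum_congr rfl fun j _ => Finset.sum_congr rfl fun k _ => ?_
    ring
  have e5 : ∑ j, ∑ k, θ j k * x j * (x k - y k) =
      ∑ j, ∑ k, θ j k * x j * x k - ∑ j, ∑ k, θ j k * x j * y k := by
    simp only [← Finset.sum_sub_distrib]
    refine Finset.sum_congr rfl fun j _ => Finset.sum_congr rfl fun k _ => ?_
    ring
  rw [e0, e1, e5]
  linarith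

lemma Pop_eq {n : ℕ} {θ : Fin n → Fin n → ℝ} (hsym : ∀ j k, θ j k = θ k j)
    {A : Finset (Fin n)} (h0 : ∀ j ∈ A, ∀ k ∈ A, θ j k = 0) :
    Pgen n (alphaAngle n θ) A = Matrix.diagonal (uPh n θ) * Pgen n 0 A *
      (Matrix.diagonal (uPh n θ))ᴴ := by
  ext x y
  rw [Matrix.diagonal_conjTranspose, Matrix.mul_diagonal, Matrix.diagonal_mul]
  simp only [Pgen, Matrix.of_apply, Pi.star_apply]
  by_cases h : ∀ j ∉ A, x j = y j
  · rw [if_pos h, if_pos h]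
    have e := uPh_mul_star n θ x y
    rw [phase_identity hsym h0 (fun j => bR (x j)) (fun j => bR (y j))
      (fun j hj => by rw [h j hj])] at e
    rw [mul_right_comm, e]
    simp only [Pi.zero_apply, phase_zero]
    rw [Complex.ofReal_sum, Finset.mul_sum, Complex.exp_sum, ← Finset.prod_mul_distrib]
    refine Finset.prod_congr rfl fun k _ => ?_
    unfold phaseFac alphaAngle
    ring
  · rw [if_neg h, if_neg h]; simp

lemma alpha_inv {n : ℕ} {θ : Fin n → Fin n → ℝ}
    {A : Finset (Fin n)} (h0 : ∀ j ∈ A, ∀ k ∈ A, θ j k = 0) : InvA n (alphaAngle n θ) A := by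
  intro k hk x y hxy
  unfold alphaAngle
  refine Finset.sum_congr rfl fun j _ => ?_
  by_cases hj : j ∈ A
  · rw [h0 j hj k hk]; simp
  · rw [hxy j hj]

lemma ideal_bound {n m : ℕ} {θ : Fin n → Fin n → ℝ} (hsym : ∀ j k, θ j k = θ k j)
    (A : Fin m → Finset (Fin n))
    (hdisj : ∀ l l', l ≠ l' → Disjoint (A l) (A l'))
    (hcover : ∀ v : Fin n, ∃ l, v ∈ A l)
    (h0 : ∀ l, ∀ j ∈ A l, ∀ k ∈ A l, θ j k = 0) :
    (∑ l, (1 - Pgen n (alphaAngle n θ) (A l)) - (1 - gProj n θ)).PosSemidef := by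
  have hu : Finset.univ.biUnion A = Finset.univ := by
    ext v; simp [hcover v]
  have h1 := (union_bound A hdisj Finset.univ).mul_mul_conjTranspose_same
    (Matrix.diagonal (uPh n θ))
  have hD : Matrix.diagonal (uPh n θ) * (Matrix.diagonal (uPh n θ))ᴴ = 1 := by
    rw [Matrix.diagonal_conjTranspose, Matrix.diagonal_mul_diagonal, ← Matrix.diagonal_one]
    congr 1
    funext x
    rw [Pi.star_apply, uPh_mul_star]; simp
  convert h1 using 1
  rw [hu, gProj_eq]
  simp only [Matrix.mul_sub, Matrix.sub_mul, Matrix.mul_sum, Matrix.sum_mul, Matrix.mul_one, hD]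
  congr 1
  exact Finset.sum_congr rfl fun l _ => by rw [Pop_eq hsym (h0 l)]

end WG

/-- For every density matrix `σ`, with `F = ⟨G|σ|G⟩`:
`Tr[σ Ω_h(𝒜)] ≤ 1 - (1-F)/m + (∑_l |A_l|/m) sin(π/4h)`. -/
theorem trace_OmegaAH_upper_bound
    (n m : ℕ) (hn : 1 ≤ n) (hm : 1 ≤ m)
    (G : SimpleGraph (Fin n)) (θ : Fin n → Fin n → ℝ)
    (hsym : ∀ j k, θ j k = θ k j)
    (hθ : ∀ j k, ¬ G.Adj j k → θ j k = 0)
    (A : Fin m → Finset (Fin n))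
    (hdisj : ∀ l l', l ≠ l' → Disjoint (A l) (A l'))
    (hcover : ∀ v : Fin n, ∃ l, v ∈ A l)
    (hne : ∀ l, (A l).Nonempty)
    (hind : ∀ l, ∀ j ∈ A l, ∀ k ∈ A l, ¬ G.Adj j k)
    (h : ℕ) (hh : 1 ≤ h)
    (σ : QOp n) (hσ : σ.PosSemidef) (hσ1 : σ.trace = 1) :
    ((σ * OmegaAH n m θ h A).trace).re ≤
      1 - (1 - (star (gVec n θ) ⬝ᵥ (σ *ᵥ gVec n θ)).re) / m +
        ((∑ l, ((A l).card : ℝ)) / m) * Real.sin (Real.pi / (4 * h)) := by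
  have h0 : ∀ l, ∀ j ∈ A l, ∀ k ∈ A l, θ j k = 0 :=
    fun l j hj k hk => hθ j k (hind l j hj k hk)
  have hs : 0 ≤ Real.sin (Real.pi / (4 * h)) := by
    have hp := Real.pi_pos
    have hh' : (1:ℝ) ≤ h := by exact_mod_cast hh
    refine Real.sin_nonneg_of_nonneg_of_le_pi (by positivity) ?_
    exact div_le_self hp.le (by linarith)
  have hm0 : (0:ℝ) < m := by exact_mod_cast hm
  set s := Real.sin (Real.pi / (4 * h)) with hsdef
  have hdiff : ∀ l, ((σ * PopH n θ h (A l)).trace).re ≤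
      ((σ * Pgen n (alphaAngle n θ) (A l)).trace).re + (A l).card * s := by
    intro l
    have ha := alpha_inv (h0 l)
    have hb : InvA n (fun k x => alphaH h (alphaAngle n θ k x)) (A l) := by
      intro k hk x y hxy
      simp only [ha k hk x y hxy]
    have e : PopH n θ h (A l) = Pgen n (fun k x => alphaH h (alphaAngle n θ k x)) (A l) := rfl
    rw [e]
    have h1 := Pgen_diff hb ha hs (fun k x => alphaH_bound h hh _) (A l) subset_rfl
    have h2 := tr_le_norm hσ hσ1
      ((Pgen_herm hb (S := A l) subset_rfl).sub (Pgen_herm ha (S := A l) subset_rfl))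
    rw [Matrix.mul_sub, Matrix.trace_sub, Complex.sub_re] at h2
    linarith
  have hid := tr_nonneg hσ (ideal_bound hsym A hdisj hcover h0)
  have hF : (σ * gProj n θ).trace = star (gVec n θ) ⬝ᵥ (σ *ᵥ gVec n θ) := by
    rw [gProj, Matrix.mul_vecMulVec, Matrix.trace_vecMulVec, dotProduct_comm]
  simp only [Matrix.mul_sub, Matrix.mul_sum, Matrix.trace_sub, Matrix.trace_sum, Matrix.mul_one,
    hσ1, hF, Complex.sub_re, Complex.re_sum, Complex.one_re, Finset.sum_sub_distrib] at hid
  simp only [Finset.sum_const, Finset.card_univ, Fintype.card_fin, nsmul_eq_mul, mul_one] at hid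
  have hsum := Finset.sum_le_sum fun l (_ : l ∈ Finset.univ) => hdiff l
  rw [Finset.sum_add_distrib, ← Finset.sum_mul] at hsum
  have hO : ((σ * OmegaAH n m θ h A).trace).re =
      (∑ l, ((σ * PopH n θ h (A l)).trace).re) / m := by
    rw [OmegaAH, Matrix.mul_smul, Matrix.trace_smul, Matrix.mul_sum, Matrix.trace_sum,
      smul_eq_mul, ← Complex.re_sum, div_eq_inv_mul, ← Complex.re_ofReal_mul]
    push_cast
    rfl
  rw [hO]
  set F := (star (gVec n θ) ⬝ᵥ (σ *ᵥ gVec n θ)).re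
  have e : 1 - (1 - F) / m + ((∑ l, ((A l).card : ℝ)) / m) * s =
      (m - (1 - F) + (∑ l, ((A l).card : ℝ)) * s) / m := by
    field_simp
  rw [e]
  gcongr
  linarith

end
end
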